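/- The join X * Y of a nonempty space X and an n-connected space Y is (n+1)-connected; consequently, the 8-fold join of a discrete set with at least one point (e.g., 9 points) is 6-connected. -/

import Mathlib

universe u v

/-- The join relation on `X × Y × [0,1]`: `(x, y, 0) ∼ (x, y', 0)` and
`(x, y, 1) ∼ (x', y, 1)`. -/
def JoinRel (X : Type u) (Y : Type v) :
    X × Y × unitInterval → X × Y × unitInterval → Prop := fun a b =>
  (a.2.2 = 0 ∧ b.2.2 = 0 ∧ a.1 = b.1) ∨ (a.2.2 = 1 ∧ b.2.2 = 1 ∧ a.2.1 = b.2.1)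

/-- The topological join `X * Y`; when `X` and `Y` are topological spaces it carries
the quotient topology. -/
def Join (X : Type u) (Y : Type v) : Type (max u v) :=
  Quot (JoinRel X Y)

instance (X : Type u) (Y : Type v) [TopologicalSpace X] [TopologicalSpace Y] :
    TopologicalSpace (Join X Y) :=
  instTopologicalSpaceQuot

/-- A space is `n`-connected if it is nonempty and all its homotopy groups vanish in
dimensions `≤ n` (where vanishing of `π₀` means path-connectedness). -/
def IsNConnected (n : ℕ) (X : Type u) [TopologicalSpace X] : Prop :=
  Nonempty X ∧ ∀ k : ℕ, k ≤ n → ∀ x : X, Subsingleton (HomotopyGroup (Fin k) X x)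

/-- `joinIter F k` is the `(k+1)`-fold join `F^{*(k+1)}` of `F` with itself. -/
def joinIter (F : Type u) : ℕ → Type u
  | 0 => F
  | n + 1 => Join F (joinIter F n)

instance joinIterTop (F : Type u) [TopologicalSpace F] :
    ∀ n, TopologicalSpace (joinIter F n)
  | 0 => inferInstanceAs (TopologicalSpace F)
  | n + 1 =>
    letI := joinIterTop F n
    inferInstanceAs (TopologicalSpace (Join F (joinIter F n)))

open Set Metric Topology


theorem glue_closed {α β : Type*} [TopologicalSpace α] [TopologicalSpace β] {s t : Set α}
    (hs : IsClosed s) (ht : IsClosed t) {f g : α → β} (hf : ContinuousOn f s)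
    (hg : ContinuousOn g t) (h : ∀ x ∈ s, x ∈ t → f x = g x) :
    ∃ k : α → β, ContinuousOn k (s ∪ t) ∧ EqOn k f s ∧ EqOn k g t := by
  classical
  have h1 : EqOn (s.piecewise f g) f s := fun x hx => by simp [hx]
  have h2 : EqOn (s.piecewise f g) g t := fun x hx => by
    by_cases hxs : x ∈ s
    · simp [hxs, h x hxs hx]
    · simp [hxs]
  exact ⟨s.piecewise f g, (hf.congr h1).union_of_isClosed (hg.congr h2) hs ht, h1, h2⟩

section hep
variable {E : Type*} [NormedAddCommGroup E] [NormedSpace ℝ E]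

theorem exists_retr : ∃ r : E × ℝ → E × ℝ,
    ContinuousOn r (closedBall 0 1 ×ˢ Icc (-1) 1) ∧
    (∀ z ∈ (closedBall 0 1 ×ˢ Icc (-1) 1 : Set (E × ℝ)),
      ((r z).2 = -1 ∧ (r z).1 ∈ closedBall (0 : E) 1) ∨
      ((r z).1 ∈ sphere (0 : E) 1 ∧ (r z).2 ∈ Icc (-1 : ℝ) 1)) ∧
    (∀ x ∈ closedBall (0 : E) 1, r (x, -1) = (x, -1)) ∧
    (∀ x ∈ sphere (0 : E) 1, ∀ t ∈ Icc (-1 : ℝ) 1, r (x, t) = (x, t)) := by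
  let M : E × ℝ → ℝ := fun z => max ‖z.1‖ ((3 - z.2) / 4)
  have hMpos : ∀ z ∈ (closedBall 0 1 ×ˢ Icc (-1) 1 : Set (E × ℝ)), 0 < M z := by
    rintro ⟨x, t⟩ ⟨_, h1, h2⟩
    apply lt_max_of_lt_right
    simp only at *
    linarith
  have hMc : Continuous M := by fun_prop
  refine ⟨fun z => ((M z)⁻¹ • z.1, 3 - (3 - z.2) * (M z)⁻¹), ?_, ?_, ?_, ?_⟩
  · have hi : ContinuousOn (fun z => (M z)⁻¹) (closedBall 0 1 ×ˢ Icc (-1) 1 : Set (E × ℝ)) :=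
      hMc.continuousOn.inv₀ fun z hz => (hMpos z hz).ne'
    fun_prop
  · rintro ⟨x, t⟩ hz
    have hp := hMpos _ hz
    obtain ⟨hx, h1, h2⟩ := hz
    simp only [mem_closedBall, dist_zero_right, mem_sphere, mem_Icc] at *
    rcases le_total ‖x‖ ((3 - t) / 4) with h | h
    · left
      have hM : M (x, t) = (3 - t) / 4 := max_eq_right h
      rw [hM] at hp ⊢
      constructor
      · have : (3 - t) ≠ 0 := by linarith
        field_simp
        norm_num
      · rw [norm_smul, Real.norm_of_nonneg (by positivity), inv_mul_le_iff₀ hp]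
        linarith
    · right
      have hM : M (x, t) = ‖x‖ := max_eq_left h
      rw [hM] at hp ⊢
      refine ⟨?_, ?_, ?_⟩
      · rw [norm_smul, Real.norm_of_nonneg (by positivity), inv_mul_cancel₀ hp.ne']
      · have : (3 - t) * ‖x‖⁻¹ ≤ 4 := by
          rw [← div_eq_mul_inv, div_le_iff₀ hp]; linarith
        linarith
      · have : 2 ≤ (3 - t) * ‖x‖⁻¹ := by
          rw [← div_eq_mul_inv, le_div_iff₀ hp]; linarith
        linarith
  · intro x hx
    simp only [mem_closedBall, dist_zero_right] at hx
    have hM : M (x, -1) = 1 := by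
      simp only [M]; norm_num [hx]
    simp [hM]
  · intro x hx t ht
    simp only [mem_sphere, dist_zero_right] at hx
    have hM : M (x, t) = 1 := by
      simp only [M, hx]
      apply max_eq_left
      have := ht.1
      linarith
    simp [hM]

variable {Z : Type*} [TopologicalSpace Z]

/-- Homotopy extension for (ball, sphere), time interval `[-1,1]`. -/
theorem hep {F : E → Z} {H : E × ℝ → Z} (hF : ContinuousOn F (closedBall 0 1))
    (hH : ContinuousOn H (sphere 0 1 ×ˢ Icc (-1) 1))
    (h0 : ∀ x ∈ sphere (0 : E) 1, H (x, -1) = F x) :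
    ∃ G : E × ℝ → Z, ContinuousOn G (closedBall 0 1 ×ˢ Icc (-1) 1) ∧
      (∀ x ∈ closedBall (0 : E) 1, G (x, -1) = F x) ∧
      ∀ x ∈ sphere (0 : E) 1, ∀ t ∈ Icc (-1 : ℝ) 1, G (x, t) = H (x, t) := by
  obtain ⟨r, rc, rm, r1, r2⟩ := exists_retr (E := E)
  obtain ⟨k, kc, k1, k2⟩ := glue_closed (s := closedBall (0 : E) 1 ×ˢ ({-1} : Set ℝ))
    (t := sphere (0 : E) 1 ×ˢ Icc (-1 : ℝ) 1) (isClosed_closedBall.prod isClosed_singleton)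
    (isClosed_sphere.prod isClosed_Icc) (f := fun z => F z.1) (g := H)
    (hF.comp continuousOn_fst fun z hz => hz.1) hH (by
      rintro ⟨x, t⟩ ⟨h1, h2⟩ ⟨h3, h4⟩
      simp only [mem_singleton_iff] at h2
      subst h2
      exact (h0 x h3).symm)
  refine ⟨k ∘ r, kc.comp rc ?_, ?_, ?_⟩
  · intro z hz
    rcases rm z hz with ⟨h, h'⟩ | ⟨h, h'⟩
    · exact Or.inl ⟨h', h⟩
    · exact Or.inr ⟨h, h'⟩
  · intro x hx
    simp only [Function.comp, r1 x hx]
    exact k1 ⟨hx, rfl⟩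
  · intro x hx t ht
    simp only [Function.comp, r2 x hx t ht]
    exact k2 ⟨hx, ht⟩

/-- Every map from the unit sphere of `E` to `Z` extends to the unit ball. -/
def SphExt (E : Type*) [NormedAddCommGroup E] (Z : Type*) [TopologicalSpace Z] : Prop :=
  ∀ f : E → Z, ContinuousOn f (sphere 0 1) →
    ∃ g : E → Z, ContinuousOn g (closedBall 0 1) ∧ EqOn g f (sphere 0 1)

/-- Extendability is homotopy invariant. -/
theorem ext_of_homotopy {f f' : E → Z} (H : E × ℝ → Z)
    (hH : ContinuousOn H (sphere 0 1 ×ˢ Icc 0 1))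
    (h0 : ∀ x ∈ sphere (0 : E) 1, H (x, 0) = f x) (h1 : ∀ x ∈ sphere (0 : E) 1, H (x, 1) = f' x)
    (h : ∃ g : E → Z, ContinuousOn g (closedBall 0 1) ∧ EqOn g f' (sphere 0 1)) :
    ∃ g : E → Z, ContinuousOn g (closedBall 0 1) ∧ EqOn g f (sphere 0 1) := by
  obtain ⟨g, gc, ge⟩ := h
  obtain ⟨G, Gc, G0, G1⟩ := hep (F := g) (H := fun z => H (z.1, (1 - z.2) / 2)) gc
    (by
      refine hH.comp (by fun_prop) ?_
      rintro ⟨x, t⟩ ⟨h1, h2, h3⟩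
      refine ⟨h1, ?_, ?_⟩ <;> simp only at * <;> linarith)
    (by
      intro x hx
      norm_num
      rw [h1 x hx, ge hx])
  refine ⟨fun x => G (x, 1), Gc.comp (by fun_prop) fun x hx => ⟨hx, by norm_num⟩, ?_⟩
  intro x hx
  simp only
  rw [G1 x hx 1 (by norm_num)]
  norm_num
  exact h0 x hx

theorem SphExt.congr {E' : Type*} [NormedAddCommGroup E'] [NormedSpace ℝ E']
    (e : E' ≃ₗᵢ[ℝ] E) (h : SphExt E Z) : SphExt E' Z := by
  intro f hf
  obtain ⟨g, gc, ge⟩ := h (f ∘ e.symm) (hf.comp e.symm.continuous.continuousOn fun x hx => by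
    simpa using hx)
  refine ⟨g ∘ e, gc.comp e.continuous.continuousOn fun x hx => by simpa using hx, fun x hx => ?_⟩
  have : e x ∈ sphere (0 : E) 1 := by simpa using hx
  simp [ge this]

theorem sphere_prod_iff {x : E} {t : ℝ} : (x, t) ∈ sphere (0 : E × ℝ) 1 ↔
    (x ∈ sphere (0 : E) 1 ∧ t ∈ Icc (-1 : ℝ) 1) ∨ (x ∈ closedBall (0 : E) 1 ∧ (t = -1 ∨ t = 1)) := by
  simp only [mem_sphere, dist_zero_right, mem_closedBall, mem_Icc, Prod.norm_def, Real.norm_eq_abs,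
    ← abs_le]
  have : (t = -1 ∨ t = 1) ↔ |t| = 1 := by rw [abs_eq (by norm_num)]; tauto
  rw [this]
  constructor
  · intro h
    rcases max_choice ‖x‖ |t| with h' | h'
    · left; exact ⟨h' ▸ h, h ▸ le_max_right _ _⟩
    · right; exact ⟨h ▸ le_max_left _ _, h' ▸ h⟩
  · rintro (⟨h, h'⟩ | ⟨h, h'⟩)
    · rw [h, max_eq_left h']
    · rw [h', max_eq_right h]

theorem ball_prod : closedBall (0 : E × ℝ) 1 = closedBall (0 : E) 1 ×ˢ Icc (-1 : ℝ) 1 := by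
  have : (0 : E × ℝ) = (0, 0) := rfl
  rw [this, ← closedBall_prod_same, Real.closedBall_eq_Icc]
  norm_num

/-- If all loops on the ball of `E` are null, spheres in `E × ℝ` bound. -/
theorem sphExt_of_loops
    (hL : ∀ (y : Z) (a : E → Z), ContinuousOn a (closedBall 0 1) → (∀ x ∈ sphere (0 : E) 1, a x = y) →
      ∃ L : E × ℝ → Z, ContinuousOn L (closedBall 0 1 ×ˢ Icc (-1) 1) ∧
        (∀ x ∈ closedBall (0 : E) 1, L (x, 1) = a x) ∧
        (∀ x ∈ closedBall (0 : E) 1, L (x, -1) = y) ∧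
        (∀ x ∈ sphere (0 : E) 1, ∀ t ∈ Icc (-1 : ℝ) 1, L (x, t) = y)) :
    SphExt (E × ℝ) Z := by
  intro f hf
  obtain ⟨r, rc, rm, r1, r2⟩ := exists_retr (E := E)
  have rS : ∀ z ∈ closedBall (0 : E × ℝ) 1, r z ∈ sphere (0 : E × ℝ) 1 := by
    intro z hz
    rw [ball_prod] at hz
    have : r z = ((r z).1, (r z).2) := rfl
    rw [this, sphere_prod_iff]
    rcases rm z hz with ⟨h, h'⟩ | ⟨h, h'⟩
    · exact Or.inr ⟨h', Or.inl h⟩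
    · exact Or.inl ⟨h, h'⟩
  -- contraction of the sphere minus the top
  let b : E × ℝ := (0, -1)
  have hb : b ∈ closedBall (0 : E × ℝ) 1 := by rw [ball_prod]; simp [b]
  let c : (E × ℝ) × ℝ → E × ℝ := fun w => (1 - w.2) • w.1 + w.2 • b
  have cc : Continuous c := by fun_prop
  have cB : ∀ z ∈ closedBall (0 : E × ℝ) 1, ∀ s ∈ Icc (0 : ℝ) 1, c (z, s) ∈ closedBall (0 : E × ℝ) 1 := by
    intro z hz s hs
    exact (convex_closedBall (0 : E × ℝ) 1) hz hb (by linarith [hs.2]) hs.1 (by ring)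
  let K : (E × ℝ) × ℝ → Z := fun w => f (r (c w))
  have Kc : ContinuousOn K (closedBall 0 1 ×ˢ Icc 0 1) := by
    refine hf.comp (rc.comp cc.continuousOn ?_) ?_
    · rintro ⟨z, s⟩ ⟨h1, h2⟩
      rw [← ball_prod]
      exact cB z h1 s h2
    · rintro ⟨z, s⟩ ⟨h1, h2⟩
      exact rS _ (cB z h1 s h2)
  have K1 : ∀ z, K (z, 1) = f b := by
    intro z
    have : c (z, 1) = b := by simp [c]
    simp only [K, this]
    rw [r1 0 (by simp)]
  have K0 : ∀ z, r z = z → K (z, 0) = f z := by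
    intro z hz
    have : c (z, 0) = z := by simp [c]
    simp only [K, this, hz]
  obtain ⟨G, Gc, G0, G1⟩ := hep (F := fun x => f (x, 1)) (H := fun z => K ((z.1, 1), (z.2 + 1) / 2))
    (hf.comp (by fun_prop) fun x hx => sphere_prod_iff.2 (Or.inr ⟨hx, Or.inr rfl⟩))
    (by
      refine Kc.comp (by fun_prop) ?_
      rintro ⟨x, t⟩ ⟨h1, h2, h3⟩
      refine ⟨?_, ?_, ?_⟩
      · rw [ball_prod]
        exact ⟨sphere_subset_closedBall h1, by norm_num⟩
      all_goals simp only at *; linarith)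
    (by
      intro x hx
      norm_num
      exact K0 _ (r2 x hx 1 (by norm_num)))
  obtain ⟨L, Lc, L1, L0, LS⟩ := hL (f b) (fun x => G (x, 1))
    (Gc.comp (by fun_prop) fun x hx => ⟨hx, by norm_num⟩)
    (by
      intro x hx
      rw [G1 x hx 1 (by norm_num)]
      norm_num
      exact K1 _)
  -- homotopy on the sphere
  have hcl1 : IsClosed {w : (E × ℝ) × ℝ | w.1 ∈ closedBall (0 : E × ℝ) 1 ∧ w.1.2 = 1 ∧ w.2 ∈ Icc (0 : ℝ) 1} :=
    (isClosed_closedBall.preimage continuous_fst).inter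
      ((isClosed_eq (by fun_prop) (by fun_prop)).inter (isClosed_Icc.preimage continuous_snd))
  have hcl2 : IsClosed {w : (E × ℝ) × ℝ | w.1 ∈ closedBall (0 : E × ℝ) 1 ∧
      (w.1.1 ∈ sphere (0 : E) 1 ∨ w.1.2 = -1) ∧ w.2 ∈ Icc (0 : ℝ) 1} :=
    (isClosed_closedBall.preimage continuous_fst).inter
      (((isClosed_sphere.preimage (continuous_fst.comp continuous_fst)).union
        (isClosed_eq (by fun_prop) (by fun_prop))).inter (isClosed_Icc.preimage continuous_snd))
  obtain ⟨k, kc, k1, k2⟩ := glue_closed hcl1 hcl2 (f := fun w => G (w.1.1, 2 * w.2 - 1)) (g := K)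
    (by
      refine Gc.comp (by fun_prop) ?_
      rintro ⟨⟨x, t⟩, s⟩ ⟨h1, h2, h3, h4⟩
      rw [ball_prod] at h1
      refine ⟨h1.1, ?_, ?_⟩ <;> simp only at * <;> linarith)
    (Kc.mono fun w hw => ⟨hw.1, hw.2.2⟩)
    (by
      rintro ⟨⟨x, t⟩, s⟩ ⟨h1, h2, h3, h4⟩ ⟨-, h5, -⟩
      simp only at *
      subst h2
      rcases h5 with h5 | h5
      · rw [G1 x h5 _ ⟨by linarith, by linarith⟩]
        congr 2
        ring
      · norm_num at h5)
  have rJ : ∀ x t, (x, t) ∈ closedBall (0 : E × ℝ) 1 → (x ∈ sphere (0 : E) 1 ∨ t = -1) →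
      r (x, t) = (x, t) := by
    rintro x t h1 (h2 | h2)
    · rw [ball_prod] at h1
      exact r2 x h2 t h1.2
    · rw [ball_prod] at h1
      subst h2
      exact r1 x h1.1
  refine ext_of_homotopy (f' := fun z => L z) k (kc.mono ?_) ?_ ?_ ⟨L, ?_, fun _ _ => rfl⟩
  · rintro ⟨⟨x, t⟩, s⟩ ⟨h1, h2⟩
    have h1' := sphere_subset_closedBall h1
    rcases sphere_prod_iff.1 h1 with ⟨h, -⟩ | ⟨h, h' | h'⟩
    · exact Or.inr ⟨h1', Or.inl h, h2⟩
    · exact Or.inr ⟨h1', Or.inr h', h2⟩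
    · exact Or.inl ⟨h1', h', h2⟩
  · rintro ⟨x, t⟩ h1
    have h1' := sphere_subset_closedBall h1
    rcases sphere_prod_iff.1 h1 with ⟨h, -⟩ | ⟨h, h' | h'⟩
    · rw [k2 ⟨h1', Or.inl h, by norm_num⟩]
      exact K0 _ (rJ _ _ h1' (Or.inl h))
    · rw [k2 ⟨h1', Or.inr h', by norm_num⟩]
      exact K0 _ (rJ _ _ h1' (Or.inr h'))
    · rw [k1 ⟨h1', h', by norm_num⟩]
      subst h'
      norm_num
      exact G0 x h
  · rintro ⟨x, t⟩ h1
    have h1' := sphere_subset_closedBall h1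
    rcases sphere_prod_iff.1 h1 with ⟨h, h''⟩ | ⟨h, h' | h'⟩
    · rw [k2 ⟨h1', Or.inl h, by norm_num⟩, K1, LS x h t h'']
    · rw [k2 ⟨h1', Or.inr h', by norm_num⟩, K1]
      subst h'
      rw [L0 x h]
    · rw [k1 ⟨h1', h', by norm_num⟩]
      subst h'
      rw [L1 x h]
      norm_num
  · rw [ball_prod]
    exact Lc

end hep

section cells
variable {m : ℕ}

/-- `d` is a face of `c`. -/
def CFace (d c : Fin m → ℤ) : Prop := ∀ i, 2 * (c i / 2) ≤ d i ∧ d i ≤ 2 * ((c i + 1) / 2)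

/-- The open cell containing a point. -/
noncomputable def cellOf (x : Fin m → ℝ) : Fin m → ℤ := fun i => ⌊x i⌋ + ⌈x i⌉

/-- The realization of a set of cells. -/
def cReal (S : Set (Fin m → ℤ)) : Set (Fin m → ℝ) := {x | cellOf x ∈ S}

theorem CFace.refl (c : Fin m → ℤ) : CFace c c := fun i => by omega

theorem CFace.trans {a b c : Fin m → ℤ} (h : CFace a b) (h' : CFace b c) : CFace a c := fun i => by
  have := h i
  have := h' i
  omega

/-- one-dimensional computation -/
theorem cell_one (x : ℝ) (c : ℤ) :
    (2 * (c / 2) ≤ ⌊x⌋ + ⌈x⌉ ∧ ⌊x⌋ + ⌈x⌉ ≤ 2 * ((c + 1) / 2)) ↔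
      ((c / 2 : ℤ) : ℝ) ≤ x ∧ x ≤ (((c + 1) / 2 : ℤ) : ℝ) := by
  have h1 := Int.floor_le_ceil x
  have h2 := Int.ceil_le_floor_add_one x
  rw [← Int.le_floor, ← Int.ceil_le]
  omega

theorem cface_cellOf {x : Fin m → ℝ} {c : Fin m → ℤ} : CFace (cellOf x) c ↔
    ∀ i, ((c i / 2 : ℤ) : ℝ) ≤ x i ∧ x i ≤ (((c i + 1) / 2 : ℤ) : ℝ) :=
  forall_congr' fun i => cell_one (x i) (c i)

theorem isClosed_cell (c : Fin m → ℤ) : IsClosed {x : Fin m → ℝ | CFace (cellOf x) c} := by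
  simp only [cface_cellOf, ofPred_forall]
  refine isClosed_iInter fun i => ?_
  exact isClosed_Icc.preimage (continuous_apply i)

theorem isClosed_cReal (S : Finset (Fin m → ℤ)) (hS : ∀ c ∈ S, ∀ d, CFace d c → d ∈ S) :
    IsClosed (cReal (S : Set (Fin m → ℤ))) := by
  have : cReal (S : Set (Fin m → ℤ)) = ⋃ c ∈ S, {x : Fin m → ℝ | CFace (cellOf x) c} := by
    ext x
    simp only [cReal, mem_ofPred_eq, mem_iUnion, Finset.mem_coe, exists_prop]
    exact ⟨fun h => ⟨_, h, CFace.refl _⟩, fun ⟨c, h, h'⟩ => hS c h _ h'⟩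
  rw [this]
  exact isClosed_biUnion_finset fun c _ => isClosed_cell c

theorem cellOf_eq_iff_odd {x : ℝ} {c : ℤ} (hc : Odd c) (hx : |2 * x - c| ≤ 1) :
    ⌊x⌋ + ⌈x⌉ = c ↔ |2 * x - c| < 1 := by
  obtain ⟨a, rfl⟩ := hc
  rw [abs_le] at hx
  rw [abs_lt]
  push_cast at *
  have h1 := Int.floor_le_ceil x
  have h2 := Int.ceil_le_floor_add_one x
  have h3 : a < x ↔ a < ⌈x⌉ := Int.lt_ceil.symm
  have h4 : x < (a + 1 : ℤ) ↔ ⌊x⌋ < a + 1 := Int.floor_lt.symm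
  have h5 : (a : ℝ) ≤ x ↔ a ≤ ⌊x⌋ := Int.le_floor.symm
  have h6 : x ≤ (a + 1 : ℤ) ↔ ⌈x⌉ ≤ a + 1 := Int.ceil_le.symm
  push_cast at h4 h6
  have e5 := h5.1 (by linarith)
  have e6 := h6.1 (by linarith)
  constructor
  · intro h
    have := h3.2 (by omega)
    have := h4.2 (by omega)
    constructor <;> linarith
  · rintro ⟨h, h'⟩
    have := h3.1 (by linarith)
    have := h4.1 (by linarith)
    omega

theorem cell_bounds_odd {x : ℝ} {c : ℤ} (hc : Odd c) :
    (((c / 2 : ℤ) : ℝ) ≤ x ∧ x ≤ (((c + 1) / 2 : ℤ) : ℝ)) ↔ |2 * x - c| ≤ 1 := by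
  obtain ⟨a, rfl⟩ := hc
  have h1 : (2 * a + 1) / 2 = a := by omega
  have h2 : (2 * a + 1 + 1) / 2 = a + 1 := by omega
  rw [h1, h2, abs_le]
  push_cast
  constructor <;> rintro ⟨h, h'⟩ <;> constructor <;> linarith

theorem cell_bounds_even {x : ℝ} {c : ℤ} (hc : ¬ Odd c) :
    (((c / 2 : ℤ) : ℝ) ≤ x ∧ x ≤ (((c + 1) / 2 : ℤ) : ℝ)) ↔ x = c / 2 := by
  rw [Int.not_odd_iff_even] at hc
  obtain ⟨a, rfl⟩ := hc
  have h1 : (a + a) / 2 = a := by omega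
  have h2 : (a + a + 1) / 2 = a := by omega
  rw [h1, h2]
  push_cast
  constructor
  · rintro ⟨h, h'⟩; linarith
  · intro h; constructor <;> linarith

/-- Extend over a single cell. -/
theorem extend_cell {Y : Type*} [TopologicalSpace Y] (c : Fin m → ℤ)
    (hY : SphExt ({i // Odd (c i)} → ℝ) Y) (h : (Fin m → ℝ) → Y)
    (hh : ContinuousOn h {x | CFace (cellOf x) c ∧ cellOf x ≠ c}) :
    ∃ g : (Fin m → ℝ) → Y, ContinuousOn g {x | CFace (cellOf x) c} ∧
      EqOn g h {x | CFace (cellOf x) c ∧ cellOf x ≠ c} := by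
  classical
  let J := {i // Odd (c i)}
  let p : (J → ℝ) → (Fin m → ℝ) := fun u i => if hi : Odd (c i) then (c i + u ⟨i, hi⟩) / 2 else c i / 2
  let q : (Fin m → ℝ) → (J → ℝ) := fun x j => 2 * x j.1 - c j.1
  have pc : Continuous p := by
    refine continuous_pi fun i => ?_
    by_cases hi : Odd (c i)
    · simp only [p, hi, dite_true]; fun_prop
    · simp only [p, hi, dite_false]; fun_prop
  have qc : Continuous q := by fun_prop
  have qp : ∀ u, q (p u) = u := by
    intro u
    ext ⟨i, hi⟩
    simp only [q, p, hi, dite_true]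
    ring
  have pq : ∀ x, CFace (cellOf x) c → p (q x) = x := by
    intro x hx
    rw [cface_cellOf] at hx
    ext i
    by_cases hi : Odd (c i)
    · simp only [p, q, hi, dite_true]; ring
    · simp only [p, hi, dite_false]
      exact ((cell_bounds_even hi).1 (hx i)).symm
  have hball : ∀ u, CFace (cellOf (p u)) c ↔ u ∈ closedBall (0 : J → ℝ) 1 := by
    intro u
    rw [cface_cellOf, mem_closedBall, dist_zero_right, pi_norm_le_iff_of_nonneg zero_le_one]
    constructor
    · rintro h ⟨i, hi⟩
      have := (cell_bounds_odd hi).1 (h i)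
      simpa [p, hi, mul_div_cancel₀] using this
    · intro h i
      by_cases hi : Odd (c i)
      · rw [cell_bounds_odd hi]
        simpa [p, hi, mul_div_cancel₀] using h ⟨i, hi⟩
      · rw [cell_bounds_even hi]
        simp [p, hi]
  have hsph : ∀ u ∈ closedBall (0 : J → ℝ) 1, (cellOf (p u) ≠ c ↔ u ∈ sphere (0 : J → ℝ) 1) := by
    intro u hu
    have hu' := hu
    rw [mem_closedBall, dist_zero_right] at hu
    have hu2 := (pi_norm_le_iff_of_nonneg zero_le_one).1 hu
    have : cellOf (p u) = c ↔ ‖u‖ < 1 := by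
      rw [pi_norm_lt_iff zero_lt_one, funext_iff]
      have key : ∀ i (hi : Odd (c i)), cellOf (p u) i = c i ↔ ‖u ⟨i, hi⟩‖ < 1 := by
        intro i hi
        have e : 2 * p u i - c i = u ⟨i, hi⟩ := by simp [p, hi]; ring
        have := hu2 ⟨i, hi⟩
        rw [Real.norm_eq_abs, ← e] at this
        rw [Real.norm_eq_abs, ← e]
        exact cellOf_eq_iff_odd hi this
      constructor
      · rintro h ⟨i, hi⟩
        exact (key i hi).1 (h i)
      · intro h i
        by_cases hi : Odd (c i)
        · exact (key i hi).2 (h ⟨i, hi⟩)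
        · have := (hball u).2 hu' i
          rw [Int.not_odd_iff_even] at hi
          obtain ⟨a, ha⟩ := hi
          omega
    rw [ne_eq, this, mem_sphere, dist_zero_right, not_lt]
    exact ⟨fun h => le_antisymm hu h, fun h => h.ge⟩
  obtain ⟨g, gc, ge⟩ := hY (h ∘ p) (hh.comp pc.continuousOn fun u hu => by
    have := sphere_subset_closedBall hu
    exact ⟨(hball u).2 this, (hsph u this).2 hu⟩)
  have hq : ∀ x, CFace (cellOf x) c → q x ∈ closedBall (0 : J → ℝ) 1 := by
    intro x hx
    rw [← hball, pq x hx]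
    exact hx
  refine ⟨g ∘ q, gc.comp qc.continuousOn hq, ?_⟩
  rintro x ⟨h1, h2⟩
  have : q x ∈ sphere (0 : J → ℝ) 1 := by
    rw [← hsph _ (hq x h1), pq x h1]
    exact h2
  simp only [Function.comp, ge this, pq x h1]

theorem CFace.odd_eq {d c : Fin m → ℤ} (h : CFace d c) (i : Fin m) (hi : Odd (d i)) : d i = c i := by
  have := h i
  obtain ⟨a, ha⟩ := hi
  omega

theorem CFace.card_lt {d c : Fin m → ℤ} (h : CFace d c) (hne : d ≠ c) :
    (Finset.univ.filter fun i => Odd (d i)).card < (Finset.univ.filter fun i => Odd (c i)).card := by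
  apply Finset.card_lt_card
  rw [Finset.ssubset_iff_of_subset]
  · by_contra hcon
    push Not at hcon
    apply hne
    ext i
    by_cases hi : Odd (c i)
    · have := hcon i (by simpa using hi)
      exact h.odd_eq i (by simpa using this)
    · have := h i
      rw [Int.not_odd_iff_even] at hi
      obtain ⟨a, ha⟩ := hi
      omega
  · intro i hi
    simp only [Finset.mem_filter, Finset.mem_univ, true_and] at *
    rw [← h.odd_eq i hi]
    exact hi

theorem extend_cells {Y : Type*} [TopologicalSpace Y] (S₁ : Finset (Fin m → ℤ))
    (hS₁ : ∀ c ∈ S₁, ∀ d, CFace d c → d ∈ S₁)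
    (hY : ∀ c ∈ S₁, SphExt ({i // Odd (c i)} → ℝ) Y) (n : ℕ) :
    ∀ (S₀ : Finset (Fin m → ℤ)), (∀ c ∈ S₀, ∀ d, CFace d c → d ∈ S₀) → S₀ ⊆ S₁ →
    (S₁ \ S₀).card = n → ∀ (h : (Fin m → ℝ) → Y), ContinuousOn h (cReal (S₀ : Set (Fin m → ℤ))) →
    ∃ g : (Fin m → ℝ) → Y, ContinuousOn g (cReal (S₁ : Set (Fin m → ℤ))) ∧
      EqOn g h (cReal (S₀ : Set (Fin m → ℤ))) := by
  classical
  induction n with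
  | zero =>
    intro S₀ h0 hsub hcard h hh
    have : S₀ = S₁ := by
      apply hsub.antisymm
      rw [Finset.card_eq_zero, Finset.sdiff_eq_empty_iff_subset] at hcard
      exact hcard
    subst this
    exact ⟨h, hh, fun _ _ => rfl⟩
  | succ n ih =>
    intro S₀ h0 hsub hcard h hh
    have hne : (S₁ \ S₀).Nonempty := by
      rw [← Finset.card_pos]; omega
    obtain ⟨c, hc, hmin⟩ := Finset.exists_min_image (S₁ \ S₀)
      (fun c => (Finset.univ.filter fun i => Odd (c i)).card) hne
    rw [Finset.mem_sdiff] at hc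
    have hprop : ∀ d, CFace d c → d ≠ c → d ∈ S₀ := by
      intro d hd hdc
      by_contra hcon
      have := hmin d (Finset.mem_sdiff.2 ⟨hS₁ c hc.1 d hd, hcon⟩)
      have := hd.card_lt hdc
      omega
    obtain ⟨g, gc, ge⟩ := extend_cell c (hY c hc.1) h
      (hh.mono fun x hx => hprop _ hx.1 hx.2)
    obtain ⟨k, kc, k1, k2⟩ := glue_closed (isClosed_cReal S₀ h0) (isClosed_cell c) hh gc
      (by
        intro x hx hx'
        refine (ge ⟨hx', ?_⟩).symm
        rintro e
        apply hc.2
        have : cellOf x ∈ S₀ := hx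
        rwa [e] at this)
    obtain ⟨k', kc', ke'⟩ := ih (insert c S₀)
      (by
        intro e he d hd
        rw [Finset.mem_insert] at he ⊢
        rcases he with rfl | he
        · by_cases hde : d = e
          · exact Or.inl hde
          · exact Or.inr (hprop d hd hde)
        · exact Or.inr (h0 e he d hd))
      (Finset.insert_subset hc.1 hsub)
      (by
        rw [Finset.sdiff_insert, Finset.card_erase_of_mem (Finset.mem_sdiff.2 hc), hcard]
        rfl)
      k
      (kc.mono (by
        intro x hx
        have : cellOf x ∈ insert c S₀ := hx
        rw [Finset.mem_insert] at this
        rcases this with h | h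
        · right
          show CFace (cellOf x) c
          rw [h]; exact CFace.refl c
        · exact Or.inl h))
    refine ⟨k', kc', fun x hx => ?_⟩
    rw [ke' (show cellOf x ∈ ((insert c S₀ : Finset _) : Set _) from by
      rw [Finset.mem_coe]; exact Finset.mem_insert_of_mem hx)]
    exact k1 hx

/-- The boundary cells of `[-N,N]^m`. -/
noncomputable def bdCells (m N : ℕ) : Finset (Fin m → ℤ) :=
  (Fintype.piFinset fun _ => Finset.Icc (-2 * (N : ℤ)) (2 * N)).filter
    fun c => ∃ i, c i = 2 * N ∨ c i = -2 * N

theorem mem_bdCells {N : ℕ} {c : Fin m → ℤ} : c ∈ bdCells m N ↔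
    (∀ i, -2 * (N : ℤ) ≤ c i ∧ c i ≤ 2 * N) ∧ ∃ i, c i = 2 * N ∨ c i = -2 * N := by
  simp [bdCells, Fintype.mem_piFinset]

theorem cell_le_iff (x : ℝ) (N : ℤ) : ⌊x⌋ + ⌈x⌉ ≤ 2 * N ↔ x ≤ N := by
  have h1 := Int.floor_le_ceil x
  have h2 := Int.ceil_le_floor_add_one x
  rw [← Int.ceil_le]
  omega

theorem le_cell_iff (x : ℝ) (N : ℤ) : 2 * N ≤ ⌊x⌋ + ⌈x⌉ ↔ N ≤ x := by
  have h1 := Int.floor_le_ceil x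
  have h2 := Int.ceil_le_floor_add_one x
  rw [← Int.le_floor]
  omega

theorem cReal_bdCells {N : ℕ} (hN : 0 < N) (x : Fin m → ℝ) :
    x ∈ cReal (bdCells m N : Set (Fin m → ℤ)) ↔ ‖x‖ = N := by
  have hN' : (0 : ℝ) < N := by exact_mod_cast hN
  have hle : ∀ i, (-2 * (N : ℤ) ≤ cellOf x i ∧ cellOf x i ≤ 2 * N) ↔ ‖x i‖ ≤ N := by
    intro i
    have e1 := cell_le_iff (x i) N
    have e2 := le_cell_iff (x i) (-N)
    rw [Real.norm_eq_abs, abs_le]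
    push_cast at e1 e2
    rw [← e1, ← e2]
    unfold cellOf
    constructor <;> rintro ⟨h, h'⟩ <;> constructor <;> linarith
  have heq : ∀ i, ‖x i‖ ≤ N → ((cellOf x i = 2 * N ∨ cellOf x i = -2 * N) ↔ ¬ ‖x i‖ < N) := by
    intro i hi
    have h3 := (hle i).2 hi
    have e1 := le_cell_iff (x i) N
    have e2 := cell_le_iff (x i) (-N)
    push_cast at e1 e2
    rw [Real.norm_eq_abs, not_lt, le_abs, ← e1, le_neg, ← e2]
    unfold cellOf at *
    constructor
    · rintro (h | h)
      · left; omega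
      · right; omega
    · rintro (h | h)
      · left; omega
      · right; omega
  have : x ∈ cReal (bdCells m N : Set (Fin m → ℤ)) ↔ cellOf x ∈ bdCells m N := Iff.rfl
  rw [this, mem_bdCells]
  constructor
  · rintro ⟨h, i, hi⟩
    have hx : ‖x‖ ≤ N := (pi_norm_le_iff_of_nonneg hN'.le).2 fun i => (hle i).1 (h i)
    have h2 := (heq i ((hle i).1 (h i))).1 hi
    exact le_antisymm hx ((not_lt.1 h2).trans (norm_le_pi_norm x i))
  · intro hx
    have h1 : ∀ i, ‖x i‖ ≤ N := fun i => hx ▸ norm_le_pi_norm x i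
    refine ⟨fun i => (hle i).2 (h1 i), ?_⟩
    by_contra hcon
    push Not at hcon
    have : ‖x‖ < N := (pi_norm_lt_iff hN').2 fun i => by
      by_contra h
      have := (heq i (h1 i)).2 h
      exact this.elim (hcon i).1 (hcon i).2
    linarith

theorem extend_sphere {k : ℕ} {Y : Type*} [TopologicalSpace Y]
    (hY : ∀ c : Fin (k + 1) → ℤ, (∃ i, ¬ Odd (c i)) → SphExt ({i // Odd (c i)} → ℝ) Y)
    (t : (Fin (k + 1) → ℝ) → ℝ) (ht : ContinuousOn t (sphere 0 1))
    (h : (Fin (k + 1) → ℝ) → Y) (hh : ContinuousOn h (sphere 0 1 ∩ {x | 0 < t x})) :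
    ∃ g : (Fin (k + 1) → ℝ) → Y, ContinuousOn g (sphere 0 1) ∧
      EqOn g h (sphere 0 1 ∩ {x | 1 / 3 ≤ t x}) := by
  classical
  have huc := (isCompact_sphere (0 : Fin (k + 1) → ℝ) 1).uniformContinuousOn_of_continuous ht
  rw [Metric.uniformContinuousOn_iff] at huc
  obtain ⟨δ, δpos, hδ⟩ := huc (1 / 3) (by norm_num)
  obtain ⟨N, hN⟩ := exists_nat_one_div_lt δpos
  set M : ℕ := N + 1 with hM
  have hM0 : (0 : ℝ) < M := by positivity
  have hMδ : (1 : ℝ) / M < δ := by rw [hM]; push_cast; exact hN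
  have hdown : ∀ c ∈ bdCells (k + 1) M, ∀ d, CFace d c → d ∈ bdCells (k + 1) M := by
    intro c hc d hd
    rw [mem_bdCells] at *
    obtain ⟨h1, i, hi⟩ := hc
    refine ⟨fun i => ?_, i, ?_⟩
    · have := h1 i
      have := hd i
      omega
    · have := hd i
      omega
  have hsc : ∀ w, w ∈ cReal (bdCells (k + 1) M : Set (Fin (k + 1) → ℤ)) →
      (M : ℝ)⁻¹ • w ∈ sphere (0 : Fin (k + 1) → ℝ) 1 := by
    intro w hw
    rw [cReal_bdCells (by omega)] at hw
    rw [mem_sphere, dist_zero_right, norm_smul, hw, Real.norm_of_nonneg (by positivity),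
      inv_mul_cancel₀ hM0.ne']
  let S₀ : Finset (Fin (k + 1) → ℤ) := (bdCells (k + 1) M).filter
    fun c => ∀ w, CFace (cellOf w) c → 0 < t ((M : ℝ)⁻¹ • w)
  obtain ⟨g, gc, ge⟩ := extend_cells (Y := Y) (bdCells (k + 1) M) hdown
    (by
      intro c hc
      rw [mem_bdCells] at hc
      obtain ⟨-, i, hi⟩ := hc
      refine hY c ⟨i, ?_⟩
      rintro ⟨a, ha⟩
      omega) _ S₀
    (by
      intro c hc d hd
      simp only [S₀, Finset.mem_filter] at *
      exact ⟨hdown c hc.1 d hd, fun w hw => hc.2 w (hw.trans hd)⟩)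
    (Finset.filter_subset _ _) rfl (fun w => h ((M : ℝ)⁻¹ • w))
    (by
      refine hh.comp (by fun_prop) ?_
      intro w hw
      have hw' : cellOf w ∈ S₀ := hw
      simp only [S₀, Finset.mem_filter] at hw'
      exact ⟨hsc w hw'.1, hw'.2 w (CFace.refl _)⟩)
  have hsc' : ∀ x ∈ sphere (0 : Fin (k + 1) → ℝ) 1,
      (M : ℝ) • x ∈ cReal (bdCells (k + 1) M : Set (Fin (k + 1) → ℤ)) := by
    intro x hx
    rw [mem_sphere, dist_zero_right] at hx
    rw [cReal_bdCells (by omega), norm_smul, hx, Real.norm_of_nonneg hM0.le, mul_one]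
  refine ⟨fun x => g ((M : ℝ) • x), gc.comp (by fun_prop) hsc', ?_⟩
  rintro x ⟨hx, hxt⟩
  simp only [mem_ofPred_eq] at hxt
  have hmem : (M : ℝ) • x ∈ cReal (S₀ : Set (Fin (k + 1) → ℤ)) := by
    show cellOf ((M : ℝ) • x) ∈ S₀
    simp only [S₀, Finset.mem_filter]
    refine ⟨hsc' x hx, fun w hw => ?_⟩
    have hwS : w ∈ cReal (bdCells (k + 1) M : Set (Fin (k + 1) → ℤ)) := hdown _ (hsc' x hx) _ hw
    have hd : dist x ((M : ℝ)⁻¹ • w) < δ := by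
      refine lt_of_le_of_lt ?_ hMδ
      rw [dist_pi_le_iff (by positivity)]
      intro i
      have h1 := cface_cellOf.1 hw i
      have h2 := cface_cellOf.1 (CFace.refl (cellOf ((M : ℝ) • x))) i
      set c := cellOf ((M : ℝ) • x) i
      have h3 : (c + 1) / 2 ≤ c / 2 + 1 := by omega
      have h4 : (((c + 1) / 2 : ℤ) : ℝ) ≤ ((c / 2 : ℤ) : ℝ) + 1 := by exact_mod_cast h3
      simp only [Pi.smul_apply, smul_eq_mul] at h2 ⊢
      have h5 : |(M : ℝ) * x i - w i| ≤ 1 := by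
        rw [abs_le]; constructor <;> linarith
      have h6 : x i - (M : ℝ)⁻¹ * w i = (M : ℝ)⁻¹ * (M * x i - w i) := by field_simp
      rw [Real.dist_eq, h6, abs_mul, abs_of_pos (by positivity), one_div]
      exact mul_le_of_le_one_right (by positivity) h5
    have := hδ x hx _ (hsc w hwS) hd
    rw [Real.dist_eq, abs_lt] at this
    linarith
  refine (ge hmem).trans ?_
  simp only [smul_smul, inv_mul_cancel₀ hM0.ne', one_smul]

end cells

section loops

/-- affine map from the cube to the ball -/
def cubeToBall {k : ℕ} (u : Fin k → unitInterval) : Fin k → ℝ := fun i => 2 * (u i : ℝ) - 1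

/-- map from the ball to the cube -/
noncomputable def ballToCube {k : ℕ} (x : Fin k → ℝ) : Fin k → unitInterval :=
  fun i => Set.projIcc 0 1 zero_le_one ((x i + 1) / 2)

theorem continuous_cubeToBall {k : ℕ} : Continuous (cubeToBall (k := k)) := by
  unfold cubeToBall; fun_prop

theorem continuous_ballToCube {k : ℕ} : Continuous (ballToCube (k := k)) := by
  unfold ballToCube
  refine continuous_pi fun i => continuous_projIcc.comp (by fun_prop)

theorem ballToCube_cubeToBall {k : ℕ} (u : Fin k → unitInterval) : ballToCube (cubeToBall u) = u := by
  ext i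
  simp only [ballToCube, cubeToBall]
  rw [show (2 * (u i : ℝ) - 1 + 1) / 2 = u i by ring, Set.projIcc_val]

theorem cubeToBall_ballToCube {k : ℕ} {x : Fin k → ℝ} (hx : x ∈ closedBall (0 : Fin k → ℝ) 1) :
    cubeToBall (ballToCube x) = x := by
  ext i
  rw [mem_closedBall, dist_zero_right, pi_norm_le_iff_of_nonneg zero_le_one] at hx
  have := hx i
  rw [Real.norm_eq_abs, abs_le] at this
  simp only [ballToCube, cubeToBall]
  rw [Set.projIcc_of_mem zero_le_one (x := (x i + 1) / 2) ⟨by linarith, by linarith⟩]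
  simp only
  ring

theorem cubeToBall_mem {k : ℕ} (u : Fin k → unitInterval) :
    cubeToBall u ∈ closedBall (0 : Fin k → ℝ) 1 := by
  rw [mem_closedBall, dist_zero_right, pi_norm_le_iff_of_nonneg zero_le_one]
  intro i
  rw [Real.norm_eq_abs, abs_le]
  have h1 := (u i).2.1
  have h2 := (u i).2.2
  simp only [cubeToBall]
  constructor <;> linarith

theorem cubeToBall_sphere {k : ℕ} (u : Fin k → unitInterval) :
    cubeToBall u ∈ sphere (0 : Fin k → ℝ) 1 ↔ u ∈ Cube.boundary (Fin k) := by
  have h := cubeToBall_mem u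
  have key : u ∉ Cube.boundary (Fin k) ↔ ‖cubeToBall u‖ < 1 := by
    rw [pi_norm_lt_iff zero_lt_one]
    simp only [Cube.boundary, mem_ofPred_eq, not_exists]
    refine forall_congr' fun i => ?_
    rw [Real.norm_eq_abs, abs_lt]
    have h1 := (u i).2.1
    have h2 := (u i).2.2
    simp only [cubeToBall, not_or]
    rw [← ne_eq, ← ne_eq, ← unitInterval.pos_iff_ne_zero, ← unitInterval.lt_one_iff_ne_one,
      ← Subtype.coe_lt_coe, ← Subtype.coe_lt_coe]
    simp only [Set.Icc.coe_zero, Set.Icc.coe_one]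
    constructor <;> rintro ⟨_, _⟩ <;> constructor <;> linarith
  rw [mem_closedBall, dist_zero_right] at h
  rw [mem_sphere, dist_zero_right]
  constructor
  · intro h'
    by_contra hc
    have := key.1 hc
    linarith
  · intro h'
    by_contra hc
    exact key.2 (lt_of_le_of_ne h hc) h'

theorem ballToCube_boundary {k : ℕ} {x : Fin k → ℝ} (hx : x ∈ sphere (0 : Fin k → ℝ) 1) :
    ballToCube x ∈ Cube.boundary (Fin k) := by
  rw [← cubeToBall_sphere, cubeToBall_ballToCube (sphere_subset_closedBall hx)]
  exact hx

theorem sphExt_of_pi {Y : Type*} [TopologicalSpace Y] (k : ℕ)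
    (h : ∀ y : Y, Subsingleton (HomotopyGroup (Fin k) Y y)) : SphExt ((Fin k → ℝ) × ℝ) Y := by
  apply sphExt_of_loops
  intro y a ac ha
  let γ : GenLoop (Fin k) Y y := ⟨⟨a ∘ cubeToBall,
    ac.comp_continuous continuous_cubeToBall cubeToBall_mem⟩,
    fun u hu => ha _ ((cubeToBall_sphere u).2 hu)⟩
  have hq : (Quotient.mk (GenLoop.Homotopic.setoid (Fin k) y) γ) =
      Quotient.mk (GenLoop.Homotopic.setoid (Fin k) y) GenLoop.const :=
    (h y).elim (Quotient.mk (GenLoop.Homotopic.setoid (Fin k) y) γ)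
      (Quotient.mk (GenLoop.Homotopic.setoid (Fin k) y) GenLoop.const)
  obtain ⟨H⟩ : GenLoop.Homotopic γ GenLoop.const := Quotient.exact hq
  refine ⟨fun z => H (Set.projIcc 0 1 zero_le_one ((1 - z.2) / 2), ballToCube z.1), ?_, ?_, ?_, ?_⟩
  · apply Continuous.continuousOn
    refine H.continuous.comp ((continuous_projIcc.comp (by fun_prop)).prodMk
      (continuous_ballToCube.comp continuous_fst))
  · intro x hx
    have : Set.projIcc (0 : ℝ) 1 zero_le_one ((1 - 1) / 2) = 0 := by
      norm_num
    simp only [this]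
    rw [H.apply_zero]
    show a (cubeToBall (ballToCube x)) = a x
    rw [cubeToBall_ballToCube hx]
  · intro x hx
    have : Set.projIcc (0 : ℝ) 1 zero_le_one ((1 - -1) / 2) = 1 := by
      norm_num
    simp only [this]
    rw [H.apply_one]
    rfl
  · intro x hx t ht
    simp only
    rw [H.eq_fst _ (ballToCube_boundary hx)]
    exact γ.2 _ (ballToCube_boundary hx)

theorem pi_of_sphExt {Z : Type*} [TopologicalSpace Z] (k : ℕ)
    (h : SphExt ((Fin k → ℝ) × ℝ) Z) (p : Z) : Subsingleton (HomotopyGroup (Fin k) Z p) := by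
  have key : ∀ γ : GenLoop (Fin k) Z p, GenLoop.Homotopic γ GenLoop.const := by
    intro γ
    have hcl1 : IsClosed {z : (Fin k → ℝ) × ℝ | z.2 = -1} := isClosed_eq (by fun_prop) (by fun_prop)
    have hcl2 : IsClosed {z : (Fin k → ℝ) × ℝ | z.1 ∈ sphere (0 : Fin k → ℝ) 1 ∨ z.2 = 1} :=
      (isClosed_sphere.preimage continuous_fst).union (isClosed_eq (by fun_prop) (by fun_prop))
    obtain ⟨f, fc, f1, f2⟩ := glue_closed hcl1 hcl2 (f := fun z => γ (ballToCube z.1)) (g := fun _ => p)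
      (γ.1.continuous.comp (continuous_ballToCube.comp continuous_fst)).continuousOn
      continuousOn_const
      (by
        rintro ⟨x, t⟩ h1 (h2 | h2)
        · exact γ.2 _ (ballToCube_boundary h2)
        · simp only [mem_ofPred_eq] at h1 h2
          linarith)
    obtain ⟨g, gc, ge⟩ := h f (fc.mono (by
      rintro ⟨x, t⟩ hz
      rcases sphere_prod_iff.1 hz with ⟨h, -⟩ | ⟨h, h' | h'⟩
      · exact Or.inr (Or.inl h)
      · exact Or.inl h'
      · exact Or.inr (Or.inr h')))
    have hI : ∀ u : unitInterval, 2 * (u : ℝ) - 1 ∈ Icc (-1 : ℝ) 1 := fun u =>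
      ⟨by linarith [u.2.1], by linarith [u.2.2]⟩
    refine ⟨⟨⟨⟨fun w => g (cubeToBall w.2, 2 * (w.1 : ℝ) - 1), ?_⟩, ?_, ?_⟩, ?_⟩⟩
    · refine gc.comp_continuous ((continuous_cubeToBall.comp continuous_snd).prodMk (by fun_prop)) ?_
      intro w
      rw [ball_prod]
      exact ⟨cubeToBall_mem _, hI _⟩
    · intro u
      simp only [Set.Icc.coe_zero, mul_zero, zero_sub]
      rw [ge (sphere_prod_iff.2 (Or.inr ⟨cubeToBall_mem _, Or.inl rfl⟩)), f1 rfl]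
      simp only [ballToCube_cubeToBall]
      rfl
    · intro u
      simp only [Set.Icc.coe_one]
      norm_num
      rw [ge (sphere_prod_iff.2 (Or.inr ⟨cubeToBall_mem _, Or.inr rfl⟩)), f2 (Or.inr rfl)]
    · intro s u hu
      show g (cubeToBall u, 2 * (s : ℝ) - 1) = γ u
      have hu' := (cubeToBall_sphere u).2 hu
      rw [ge (sphere_prod_iff.2 (Or.inl ⟨hu', hI s⟩)), f2 (Or.inl hu')]
      exact (γ.2 u hu).symm
  constructor
  intro a b
  refine Quotient.inductionOn₂ a b fun x y => ?_
  exact Quotient.sound ((key x).trans (key y).symm)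

/-- splitting off one coordinate -/
noncomputable def consIso (k : ℕ) : ((Fin k → ℝ) × ℝ) ≃ₗᵢ[ℝ] (Fin (k + 1) → ℝ) where
  toLinearEquiv := (LinearEquiv.prodComm ℝ (Fin k → ℝ) ℝ).trans (Fin.consLinearEquiv ℝ fun _ => ℝ)
  norm_map' := by
    rintro ⟨x, t⟩
    have : ((LinearEquiv.prodComm ℝ (Fin k → ℝ) ℝ).trans (Fin.consLinearEquiv ℝ fun _ => ℝ)) (x, t)
      = (Fin.cons t x : Fin (k + 1) → ℝ) := rfl
    rw [this]
    apply le_antisymm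
    · rw [pi_norm_le_iff_of_nonneg (norm_nonneg _)]
      intro i
      refine Fin.cases ?_ (fun i => ?_) i
      · simpa using norm_snd_le (x, t)
      · simpa using (norm_le_pi_norm x i).trans (norm_fst_le (x, t))
    · rw [Prod.norm_def]
      refine max_le ?_ ?_
      · rw [pi_norm_le_iff_of_nonneg (norm_nonneg _)]
        intro i
        simpa using norm_le_pi_norm (Fin.cons t x : Fin (k + 1) → ℝ) i.succ
      · simpa using norm_le_pi_norm (Fin.cons t x : Fin (k + 1) → ℝ) 0

/-- reindexing -/
noncomputable def reindexIso {ι κ : Type*} [Fintype ι] [Fintype κ] (e : ι ≃ κ) :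
    (κ → ℝ) ≃ₗᵢ[ℝ] (ι → ℝ) where
  toLinearEquiv := LinearEquiv.funCongrLeft ℝ ℝ e
  norm_map' := by
    intro x
    apply le_antisymm
    · rw [pi_norm_le_iff_of_nonneg (norm_nonneg _)]
      intro i
      exact norm_le_pi_norm x (e i)
    · rw [pi_norm_le_iff_of_nonneg (norm_nonneg _)]
      intro j
      have := norm_le_pi_norm (LinearEquiv.funCongrLeft ℝ ℝ e x) (e.symm j)
      simpa [LinearEquiv.funCongrLeft] using this

/-- extension property up to dimension `n` -/
def EP (n : ℕ) (Z : Type*) [TopologicalSpace Z] : Prop := ∀ j ≤ n, SphExt (Fin j → ℝ) Z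

theorem sphExt_zero (Z : Type*) [TopologicalSpace Z] : SphExt (Fin 0 → ℝ) Z := by
  intro f hf
  refine ⟨fun _ => f 0, continuousOn_const, fun x hx => ?_⟩
  rw [Subsingleton.elim x 0]

theorem EP_of_pi {Y : Type*} [TopologicalSpace Y] (n : ℕ)
    (h : ∀ k ≤ n, ∀ y : Y, Subsingleton (HomotopyGroup (Fin k) Y y)) : EP (n + 1) Y := by
  intro j hj
  cases j with
  | zero => exact sphExt_zero Y
  | succ j => exact (sphExt_of_pi j (h j (by omega))).congr (consIso j).symm

theorem pi_of_EP {Z : Type*} [TopologicalSpace Z] (n : ℕ) (h : EP (n + 1) Z) (k : ℕ) (hk : k ≤ n)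
    (z : Z) : Subsingleton (HomotopyGroup (Fin k) Z z) :=
  pi_of_sphExt k ((h (k + 1) (by omega)).congr (consIso k)) z

end loops

section join
variable {X : Type u} {Y : Type v}

/-- the quotient map -/
def jmk (a : X × Y × unitInterval) : Join X Y := Quot.mk _ a

theorem jmk_zero (x : X) (y y' : Y) : jmk (x, y, 0) = jmk (x, y', 0) :=
  Quot.sound (Or.inl ⟨rfl, rfl, rfl⟩)

theorem jmk_one (x x' : X) (y : Y) : jmk (x, y, 1) = jmk (x', y, 1) :=
  Quot.sound (Or.inr ⟨rfl, rfl, rfl⟩)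

/-- the join parameter -/
def jt : Join X Y → unitInterval := Quot.lift (fun a => a.2.2) (by
  rintro a b (⟨h1, h2, -⟩ | ⟨h1, h2, -⟩) <;> rw [h1, h2])

theorem jt_jmk (a : X × Y × unitInterval) : jt (jmk a) = a.2.2 := rfl

theorem jmk_fst {a b : X × Y × unitInterval} (h : jmk a = jmk b) (ha : a.2.2 ≠ 1) : a.1 = b.1 := by
  classical
  let G : Join X Y → Option X := Quot.lift (fun a => if a.2.2 = 1 then none else some a.1) (by
    rintro a b (⟨h1, h2, h3⟩ | ⟨h1, h2, -⟩)
    · rw [h1, h2, h3]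
    · rw [if_pos h1, if_pos h2])
  have hG : G (jmk a) = G (jmk b) := congrArg G h
  have ht : a.2.2 = b.2.2 := congrArg jt h
  have e : (if a.2.2 = 1 then none else some a.1) = (if b.2.2 = 1 then none else some b.1) := hG
  rw [if_neg ha, if_neg (ht ▸ ha)] at e
  exact Option.some.inj e

theorem jmk_snd {a b : X × Y × unitInterval} (h : jmk a = jmk b) (ha : a.2.2 ≠ 0) :
    a.2.1 = b.2.1 := by
  classical
  let G : Join X Y → Option Y := Quot.lift (fun a => if a.2.2 = 0 then none else some a.2.1) (by
    rintro a b (⟨h1, h2, -⟩ | ⟨h1, h2, h3⟩)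
    · rw [if_pos h1, if_pos h2]
    · rw [h1, h2, h3])
  have hG : G (jmk a) = G (jmk b) := congrArg G h
  have ht : a.2.2 = b.2.2 := congrArg jt h
  have e : (if a.2.2 = 0 then none else some a.2.1) = (if b.2.2 = 0 then none else some b.2.1) := hG
  rw [if_neg ha, if_neg (ht ▸ ha)] at e
  exact Option.some.inj e

/-- representatives -/
noncomputable def jout (z : Join X Y) : X × Y × unitInterval := Quot.out z

theorem jmk_jout (z : Join X Y) : jmk (jout z) = z := Quot.out_eq z

theorem jt_jout (z : Join X Y) : (jout z).2.2 = jt z := by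
  conv_rhs => rw [← jmk_jout z]
  rfl

theorem jmk_eq (z : Join X Y) : jmk ((jout z).1, (jout z).2.1, jt z) = z := by
  rw [← jt_jout]
  exact jmk_jout z

variable [TopologicalSpace X] [TopologicalSpace Y]

theorem isQuotientMap_jmk : IsQuotientMap (jmk (X := X) (Y := Y)) := isQuotientMap_quot_mk

theorem continuous_jmk : Continuous (jmk (X := X) (Y := Y)) := isQuotientMap_jmk.continuous

theorem continuous_jt : Continuous (jt (X := X) (Y := Y)) := by
  rw [isQuotientMap_jmk.continuous_iff]
  show Continuous fun a : X × Y × unitInterval => a.2.2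
  fun_prop

theorem continuousOn_jfst : ContinuousOn (fun z : Join X Y => (jout z).1) {z | jt z ≠ 1} := by
  have ho : IsOpen {z : Join X Y | jt z ≠ 1} := isOpen_compl_singleton.preimage continuous_jt
  rw [isQuotientMap_jmk.continuousOn_isOpen_iff ho]
  refine continuousOn_fst.congr fun a ha => ?_
  exact (jmk_fst (jmk_jout (jmk a)).symm ha).symm

theorem continuousOn_jsnd : ContinuousOn (fun z : Join X Y => (jout z).2.1) {z | jt z ≠ 0} := by
  have ho : IsOpen {z : Join X Y | jt z ≠ 0} := isOpen_compl_singleton.preimage continuous_jt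
  rw [isQuotientMap_jmk.continuousOn_isOpen_iff ho]
  refine ContinuousOn.congr (f := fun a : X × Y × unitInterval => a.2.1) (by fun_prop) fun a ha => ?_
  exact (jmk_snd (jmk_jout (jmk a)).symm ha).symm

/-- the reparametrization pushing the ends -/
noncomputable def jpsi (t s : ℝ) : unitInterval :=
  Set.projIcc 0 1 zero_le_one ((1 - s) * t + s * max 0 (min 1 (3 * t - 1)))

theorem jpsi_zero (s : ℝ) : jpsi 0 s = 0 := by
  unfold jpsi; norm_num

theorem jpsi_one (s : ℝ) : jpsi 1 s = 1 := by
  unfold jpsi; norm_num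

/-- deformation of the join -/
noncomputable def jdef (w : Join X Y × ℝ) : Join X Y :=
  Quot.lift (fun a : X × Y × unitInterval => jmk (a.1, a.2.1, jpsi a.2.2 w.2)) (by
    rintro ⟨x, y, t⟩ ⟨x', y', t'⟩ (⟨h1, h2, h3⟩ | ⟨h1, h2, h3⟩)
    · simp only at h1 h2 h3 ⊢
      subst h1 h2 h3
      simp only [Set.Icc.coe_zero, jpsi_zero]
      exact jmk_zero _ _ _
    · simp only at h1 h2 h3 ⊢
      subst h1 h2 h3
      simp only [Set.Icc.coe_one, jpsi_one]
      exact jmk_one _ _ _) w.1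

theorem jdef_jmk (a : X × Y × unitInterval) (s : ℝ) :
    jdef (jmk a, s) = jmk (a.1, a.2.1, jpsi a.2.2 s) := rfl

theorem continuous_jdef : Continuous (jdef (X := X) (Y := Y)) := by
  apply isQuotientMap_jmk.continuous_lift_prod_left
  simp only [jdef_jmk]
  refine continuous_jmk.comp ?_
  refine Continuous.prodMk (by fun_prop) (Continuous.prodMk (by fun_prop) ?_)
  unfold jpsi
  exact continuous_projIcc.comp (by fun_prop)

theorem jdef_eq (z : Join X Y) (s : ℝ) :
    jdef (z, s) = jmk ((jout z).1, (jout z).2.1, jpsi (jt z) s) := by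
  conv_lhs => rw [← jmk_eq z]
  rfl

theorem EP_join (n : ℕ) (hY : EP n Y) : EP (n + 1) (Join X Y) := by
  intro j hj
  cases j with
  | zero => exact sphExt_zero _
  | succ k =>
  intro f hf
  let x₀ : X := (jout (f 0)).1
  let y₀ : Y := (jout (f 0)).2.1
  let t : (Fin (k + 1) → ℝ) → ℝ := fun x => (jt (f x) : ℝ)
  have htc : ContinuousOn t (sphere 0 1) :=
    continuous_subtype_val.comp_continuousOn (continuous_jt.comp_continuousOn hf)
  obtain ⟨h, hc, he⟩ := extend_sphere (Y := Y) (k := k)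
    (by
      rintro c ⟨i, hi⟩
      have hcard : Fintype.card {i // Odd (c i)} < Fintype.card (Fin (k + 1)) :=
        Fintype.card_subtype_lt hi
      rw [Fintype.card_fin] at hcard
      exact (hY _ (by omega)).congr (reindexIso (Fintype.equivFin {i // Odd (c i)}).symm)) t htc
    (fun x => (jout (f x)).2.1)
    (continuousOn_jsnd.comp (hf.mono inter_subset_left) (by
      rintro x ⟨-, hx⟩ h0
      simp only [mem_ofPred_eq, t] at hx
      rw [h0] at hx
      simp at hx))
  let φ : ℝ → ℝ := fun t => max 0 (min 1 (3 * t - 1))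
  have hφ : Continuous φ := by fun_prop
  let P : ℝ → unitInterval := Set.projIcc 0 1 zero_le_one
  have hP : Continuous P := continuous_projIcc
  have hP0 : P 0 = 0 := by simp [P]
  have hP1 : P 1 = 1 := by simp [P]
  -- third homotopy
  have step3 : ∃ g : (Fin (k + 1) → ℝ) → Join X Y, ContinuousOn g (closedBall 0 1) ∧
      EqOn g (fun x => jmk ((jout (f x)).1, h x, 1)) (sphere 0 1) := by
    refine ext_of_homotopy (f' := fun _ => jmk (x₀, y₀, 0))
      (fun w => jmk (x₀, h w.1, P (1 - w.2))) ?_ ?_ ?_ ⟨_, continuousOn_const, fun _ _ => rfl⟩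
    · refine continuous_jmk.comp_continuousOn (continuousOn_const.prodMk (ContinuousOn.prodMk ?_ ?_))
      · exact hc.comp (by fun_prop) fun w hw => hw.1
      · exact (hP.comp (by fun_prop)).continuousOn
    · intro x hx
      simp only [sub_zero, hP1]
      exact jmk_one _ _ _
    · intro x hx
      simp only [sub_self, hP0]
      exact jmk_zero _ _ _
  have step2 : ∃ g : (Fin (k + 1) → ℝ) → Join X Y, ContinuousOn g (closedBall 0 1) ∧
      EqOn g (fun x => jdef (f x, 1)) (sphere 0 1) := by
    refine ext_of_homotopy (fun w => jmk ((jout (f w.1)).1, h w.1, P (max (φ (t w.1)) w.2)))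
      ?_ ?_ ?_ step3
    · let D : Set ((Fin (k + 1) → ℝ) × ℝ) := sphere 0 1 ×ˢ Icc 0 1
      have hD : IsClosed D := isClosed_sphere.prod isClosed_Icc
      have htD : ContinuousOn (fun w : (Fin (k + 1) → ℝ) × ℝ => t w.1) D :=
        htc.comp (by fun_prop) fun w hw => hw.1
      have hfD : ContinuousOn (fun w : (Fin (k + 1) → ℝ) × ℝ => f w.1) D :=
        hf.comp (by fun_prop) fun w hw => hw.1
      have hhD : ContinuousOn (fun w : (Fin (k + 1) → ℝ) × ℝ => h w.1) D :=
        hc.comp (by fun_prop) fun w hw => hw.1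
      have c1 := htD.preimage_isClosed_of_isClosed hD (isClosed_Iic (a := (3 / 4 : ℝ)))
      have c2 := htD.preimage_isClosed_of_isClosed hD (isClosed_Ici (a := (3 / 4 : ℝ)))
      refine ContinuousOn.mono (ContinuousOn.union_of_isClosed ?_ ?_ c1 c2) ?_
      · refine continuous_jmk.comp_continuousOn (ContinuousOn.prodMk ?_ (ContinuousOn.prodMk ?_ ?_))
        · refine continuousOn_jfst.comp (hfD.mono inter_subset_left) ?_
          rintro w ⟨-, hw⟩ h1
          have hw' : (jt (f w.1) : ℝ) ≤ 3 / 4 := hw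
          rw [h1] at hw'
          norm_num at hw'
        · exact hhD.mono inter_subset_left
        · exact hP.comp_continuousOn ((continuous_max (α := ℝ)).comp_continuousOn
            (((hφ.comp_continuousOn htD).mono inter_subset_left).prodMk continuousOn_snd))
      · refine ContinuousOn.congr (f := fun w => jmk (x₀, h w.1, 1)) ?_ ?_
        · exact continuous_jmk.comp_continuousOn (continuousOn_const.prodMk
            ((hhD.mono inter_subset_left).prodMk continuousOn_const))
        · rintro w ⟨hw1, hw⟩
          have hw' : 3 / 4 ≤ t w.1 := hw
          have e1 : φ (t w.1) = 1 := by
            simp only [φ]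
            rw [min_eq_left (by linarith)]
            norm_num
          simp only [e1]
          rw [max_eq_left hw1.2.2, hP1]
          exact jmk_one _ _ _
      · intro w hw
        rcases le_total (t w.1) (3 / 4) with h | h
        · exact Or.inl ⟨hw, h⟩
        · exact Or.inr ⟨hw, h⟩
    · intro x hx
      simp only [jdef_eq]
      have e1 : jpsi (jt (f x)) 1 = P (φ (t x)) := by
        simp [jpsi, P, φ, t]
      rw [e1, show max (φ (t x)) 0 = φ (t x) from max_eq_left (le_max_left _ _)]
      rcases le_total (1 / 3) (t x) with h3 | h3
      · rw [he ⟨hx, h3⟩]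
      · have e2 : φ (t x) = 0 := by
          simp only [φ]
          exact max_eq_left ((min_le_right _ _).trans (by linarith))
        rw [e2, hP0]
        exact jmk_zero _ _ _
    · intro x hx
      simp only
      have : max (φ (t x)) 1 = 1 := max_eq_right (max_le zero_le_one (min_le_left _ _))
      rw [this, hP1]
  refine ext_of_homotopy (fun w => jdef (f w.1, w.2)) ?_ ?_ (fun _ _ => rfl) step2
  · exact continuous_jdef.comp_continuousOn ((hf.comp (by fun_prop) fun w hw => hw.1).prodMk
      continuousOn_snd)
  · intro x hx
    simp only [jdef_eq]
    have : jpsi (jt (f x)) 0 = jt (f x) := by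
      simp [jpsi]
    rw [this, jmk_eq]

end join

/-- The join `X * Y` of a nonempty space `X` and an `n`-connected space `Y` is
`(n+1)`-connected; consequently the 8-fold join of a nonempty discrete set is
6-connected. -/
theorem stmt15 :
    (∀ (X : Type u) (Y : Type v) [TopologicalSpace X] [TopologicalSpace Y] (n : ℕ),
      Nonempty X → IsNConnected n Y → IsNConnected (n + 1) (Join X Y)) ∧
    (∀ (F : Type u) [TopologicalSpace F] [DiscreteTopology F], Nonempty F →
      IsNConnected 6 (joinIter F 7)) := by
  refine ⟨?_, ?_⟩
  · intro X Y _ _ n hX hY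
    obtain ⟨⟨y⟩, hpi⟩ := hY
    obtain ⟨x⟩ := hX
    exact ⟨⟨jmk (x, y, 0)⟩, fun k hk z => pi_of_EP (n + 1) (EP_join (n + 1) (EP_of_pi n hpi)) k hk z⟩
  · intro F _ _ hF
    have hne : ∀ n, Nonempty (joinIter F n) := by
      intro n
      induction n with
      | zero => exact hF
      | succ n ih => exact ⟨jmk (hF.some, ih.some, 0)⟩
    have hEP : ∀ n, EP n (joinIter F n) := by
      intro n
      induction n with
      | zero =>
        intro j hj
        obtain rfl : j = 0 := by omega
        exact sphExt_zero _
      | succ n ih => exact EP_join n ih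
    exact ⟨hne 7, fun k hk z => pi_of_EP 6 (hEP 7) k hk z⟩
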